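/- arXiv:2212.09188 — 2 statements merged into one kernel-verified Lean document; each statement's English description precedes it below -/
import Mathlib

section
/- Let R₅ be the tournament on vertices v₁,…,v₅ in which vᵢ → vⱼ if and only if j − i ≡ 1 or 2 (mod 5). Then inv(R₅) = 2 and inv(△(R₅)) = 2; in particular, the identity inv(△(D)) = inv(D) + 1 fails for D = R₅. -/
/-- An oriented graph: a digraph with no loops and no pair of opposite arcs. -/
structure OrientedGraph (V : Type*) where
  arc : V → V → Prop
  irrefl' : ∀ v, ¬ arc v v
  asymm' : ∀ u v, arc u v → ¬ arc v u

namespace OrientedGraph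

variable {V : Type*}

/-- An oriented graph is acyclic if it has no directed cycle. -/
def IsAcyclic (D : OrientedGraph V) : Prop := ∀ v, ¬ Relation.TransGen D.arc v v

/-- The result of inverting the sets `X 0, …, X (k-1)` one after another:
an arc is reversed iff an odd number of the sets contain both of its end-vertices. -/
def invert (D : OrientedGraph V) {k : ℕ} (X : Fin k → Set V) : OrientedGraph V where
  arc u v := (Even {i : Fin k | u ∈ X i ∧ v ∈ X i}.ncard ∧ D.arc u v) ∨
    (¬ Even {i : Fin k | u ∈ X i ∧ v ∈ X i}.ncard ∧ D.arc v u)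
  irrefl' v h := by
    rcases h with ⟨_, h⟩ | ⟨_, h⟩ <;> exact D.irrefl' v h
  asymm' u v h1 h2 := by
    have hs : {i : Fin k | v ∈ X i ∧ u ∈ X i} = {i : Fin k | u ∈ X i ∧ v ∈ X i} := by
      ext i; simp only [Set.mem_setOf_eq]; exact and_comm
    rcases h1 with ⟨hE, h1⟩ | ⟨hE, h1⟩ <;> rcases h2 with ⟨hE', h2⟩ | ⟨hE', h2⟩ <;>
      rw [hs] at hE'
    · exact D.asymm' u v h1 h2
    · exact hE' hE
    · exact hE hE'
    · exact D.asymm' v u h1 h2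

/-- A family of subsets is decycling if inverting it yields an acyclic oriented graph. -/
def IsDecycling (D : OrientedGraph V) {k : ℕ} (X : Fin k → Set V) : Prop :=
  (D.invert X).IsAcyclic

/-- The inversion number: the minimum cardinality of a decycling family. -/
noncomputable def inv (D : OrientedGraph V) : ℕ :=
  sInf {k | ∃ X : Fin k → Set V, D.IsDecycling X}

/-- A tournament: an oriented graph whose underlying graph is complete. -/
def IsTournament (D : OrientedGraph V) : Prop :=
  ∀ u v : V, u ≠ v → D.arc u v ∨ D.arc v u

/-- The subdigraph induced by a set of vertices. -/
def induce (D : OrientedGraph V) (S : Set V) : OrientedGraph S where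
  arc a b := D.arc a b
  irrefl' a := D.irrefl' a
  asymm' a b := D.asymm' a b

/-- The dijoin `L ⇒ R`: disjoint union of `L` and `R` plus all arcs from `L` to `R`. -/
def dijoin {α β : Type*} (L : OrientedGraph α) (R : OrientedGraph β) :
    OrientedGraph (α ⊕ β) where
  arc x y :=
    match x, y with
    | Sum.inl a, Sum.inl b => L.arc a b
    | Sum.inl _, Sum.inr _ => True
    | Sum.inr _, Sum.inl _ => False
    | Sum.inr a, Sum.inr b => R.arc a b
  irrefl' x := by
    cases x with
    | inl a => exact L.irrefl' a
    | inr b => exact R.irrefl' b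
  asymm' x y := by
    cases x <;> cases y
    · exact L.asymm' _ _
    · exact fun _ h => h
    · exact fun h _ => h
    · exact R.asymm' _ _

/-- The oriented graph `△(D)`, obtained from `D` by adding two new vertices `u = inr false`
and `v = inr true`, all arcs from `V(D)` to `u`, the arc `u v`, and all arcs from `v`
to `V(D)`. -/
def triangleExt (D : OrientedGraph V) : OrientedGraph (V ⊕ Bool) where
  arc x y :=
    match x, y with
    | Sum.inl a, Sum.inl b => D.arc a b
    | Sum.inl _, Sum.inr w => w = false
    | Sum.inr w, Sum.inl _ => w = true
    | Sum.inr w, Sum.inr w' => w = false ∧ w' = true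
  irrefl' x := by
    cases x with
    | inl a => exact D.irrefl' a
    | inr w => exact fun h => absurd (h.1.symm.trans h.2) (by decide)
  asymm' x y := by
    cases x <;> cases y <;> intro h1 h2
    · exact D.asymm' _ _ h1 h2
    · exact absurd (h1.symm.trans h2) (by decide)
    · exact absurd (h2.symm.trans h1) (by decide)
    · exact absurd (h1.2.symm.trans h2.1) (by decide)

end OrientedGraph

/-- `maxInv n` is the maximum of the inversion numbers of tournaments of order `n`. -/
noncomputable def maxInv (n : ℕ) : ℕ :=
  sSup {m | ∃ T : OrientedGraph (Fin n), T.IsTournament ∧ T.inv = m}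

/-- The circulant tournament `R₅` on five vertices: `vᵢ → vⱼ` iff `j - i ≡ 1, 2 (mod 5)`. -/
def R5 : OrientedGraph (Fin 5) where
  arc i j := (j.val + 5 - i.val) % 5 = 1 ∨ (j.val + 5 - i.val) % 5 = 2
  irrefl' := by decide
  asymm' := by decide

namespace OrientedGraph

/-- A relation along which a natural-valued rank increases is acyclic. -/
theorem isAcyclic_of_rank {V : Type*} (D : OrientedGraph V) (r : V → ℕ)
    (h : ∀ u v, D.arc u v → r u < r v) : D.IsAcyclic := by
  intro v hv
  have key : ∀ w, Relation.TransGen D.arc v w → r v < r w := by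
    intro w hw
    induction hw with
    | single h1 => exact h _ _ h1
    | tail _ h1 ih => exact ih.trans (h _ _ h1)
  exact lt_irrefl _ (key v hv)

/-- A decycling family of `△(D)` restricts to a decycling family of `D`. -/
theorem IsDecycling.restrict {V : Type*} {D : OrientedGraph V} {k : ℕ}
    {X : Fin k → Set (V ⊕ Bool)} (h : D.triangleExt.IsDecycling X) :
    D.IsDecycling (fun i => Sum.inl ⁻¹' X i) := by
  intro v hv
  have key : ∀ w, Relation.TransGen (D.invert (fun i => Sum.inl ⁻¹' X i)).arc v w →
      Relation.TransGen (D.triangleExt.invert X).arc (Sum.inl v) (Sum.inl w) := by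
    intro w hw
    induction hw with
    | single h1 => exact Relation.TransGen.single h1
    | tail _ h1 ih => exact ih.tail h1
  exact h (Sum.inl v) (key v hv)

end OrientedGraph

instance R5ArcDecidable (i j : Fin 5) : Decidable (R5.arc i j) :=
  inferInstanceAs (Decidable (_ ∨ _))

/-- After inverting one set, `R₅` still has a directed triangle. -/
theorem R5_triangle : ∀ f : Fin 5 → Bool, ∃ a b c : Fin 5,
    ((¬ (f a = true ∧ f b = true) ∧ R5.arc a b) ∨ ((f a = true ∧ f b = true) ∧ R5.arc b a)) ∧
    ((¬ (f b = true ∧ f c = true) ∧ R5.arc b c) ∨ ((f b = true ∧ f c = true) ∧ R5.arc c b)) ∧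
    ((¬ (f c = true ∧ f a = true) ∧ R5.arc c a) ∨ ((f c = true ∧ f a = true) ∧ R5.arc a c)) := by
  decide

theorem R5_lower {k : ℕ} (X : Fin k → Set (Fin 5)) (h : R5.IsDecycling X) : 2 ≤ k := by
  classical
  by_contra hk
  have hf : ∃ f : Fin 5 → Bool, ∀ u v,
      (¬ Even {i : Fin k | u ∈ X i ∧ v ∈ X i}.ncard) ↔ (f u = true ∧ f v = true) := by
    have hk' : k = 0 ∨ k = 1 := by omega
    rcases hk' with rfl | rfl
    · refine ⟨fun _ => false, fun u v => ?_⟩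
      have : {i : Fin 0 | u ∈ X i ∧ v ∈ X i} = ∅ := Set.eq_empty_of_isEmpty _
      simp [this]
    · refine ⟨fun u => decide (u ∈ X 0), fun u v => ?_⟩
      by_cases huv : u ∈ X 0 ∧ v ∈ X 0
      · have : {i : Fin 1 | u ∈ X i ∧ v ∈ X i} = {0} := by
          ext i
          have hi : i = 0 := Subsingleton.elim _ _
          simp [hi, huv]
        simp [this, huv]
      · have : {i : Fin 1 | u ∈ X i ∧ v ∈ X i} = ∅ := by
          ext i
          have hi : i = 0 := Subsingleton.elim _ _
          simpa [hi] using huv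
        simpa [this] using huv
  obtain ⟨f, hf⟩ := hf
  have harc : ∀ u v, ((¬ (f u = true ∧ f v = true) ∧ R5.arc u v) ∨
      ((f u = true ∧ f v = true) ∧ R5.arc v u)) → (R5.invert X).arc u v := by
    intro u v huv
    rw [← hf, not_not] at huv
    exact huv
  obtain ⟨a, b, c, hab, hbc, hca⟩ := R5_triangle f
  exact h a (((Relation.TransGen.single (harc _ _ hab)).tail (harc _ _ hbc)).tail (harc _ _ hca))

instance R5ExtArcDecidable : ∀ x y : Fin 5 ⊕ Bool, Decidable (R5.triangleExt.arc x y)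
  | Sum.inl a, Sum.inl b => R5ArcDecidable a b
  | Sum.inl _, Sum.inr w => inferInstanceAs (Decidable (w = false))
  | Sum.inr w, Sum.inl _ => inferInstanceAs (Decidable (w = true))
  | Sum.inr w, Sum.inr z => inferInstanceAs (Decidable (w = false ∧ z = true))

/-- Characteristic functions of `{v₁, v₂, u}` and `{v₃, v₄, v₅, u}`. -/
def extMem (i : Fin 2) : Fin 5 ⊕ Bool → Bool
  | Sum.inl a => if i = 0 then decide (a.val < 2) else decide (2 ≤ a.val)
  | Sum.inr w => !w

/-- The position of each vertex in the final transitive order. -/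
def extRank : Fin 5 ⊕ Bool → ℕ
  | Sum.inl a => ![5, 3, 6, 4, 2] a
  | Sum.inr w => if w = true then 1 else 0

theorem ext_rank_lt : ∀ x y : Fin 5 ⊕ Bool,
    ((Even (Finset.univ.filter fun i : Fin 2 => extMem i x = true ∧ extMem i y = true).card ∧
        R5.triangleExt.arc x y) ∨
      (¬ Even (Finset.univ.filter fun i : Fin 2 => extMem i x = true ∧ extMem i y = true).card ∧
        R5.triangleExt.arc y x)) → extRank x < extRank y := by
  decide

theorem ext_decycling :
    R5.triangleExt.IsDecycling (fun i : Fin 2 => {x | extMem i x = true}) := by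
  refine OrientedGraph.isAcyclic_of_rank _ extRank fun x y hxy => ext_rank_lt x y ?_
  have hcard : {i : Fin 2 | x ∈ {x | extMem i x = true} ∧ y ∈ {x | extMem i x = true}}.ncard =
      (Finset.univ.filter fun i : Fin 2 => extMem i x = true ∧ extMem i y = true).card := by
    rw [← Set.ncard_coe_finset]
    congr 1
    ext i
    simp
  rw [← hcard]
  exact hxy

/-- `inv(R₅) = 2` and `inv(△(R₅)) = 2`; in particular the identity
`inv(△(D)) = inv(D) + 1` fails for `D = R₅`. -/
theorem inv_triangleExt_R5 :
    R5.inv = 2 ∧ R5.triangleExt.inv = 2 ∧ R5.triangleExt.inv ≠ R5.inv + 1 := by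
  have h1 : R5.inv = 2 :=
    le_antisymm (Nat.sInf_le ⟨_, ext_decycling.restrict⟩)
      (le_csInf ⟨2, _, ext_decycling.restrict⟩ fun k ⟨X, hX⟩ => R5_lower X hX)
  have h2 : R5.triangleExt.inv = 2 :=
    le_antisymm (Nat.sInf_le ⟨_, ext_decycling⟩)
      (le_csInf ⟨2, _, ext_decycling⟩ fun k ⟨X, hX⟩ => R5_lower _ hX.restrict)
  exact ⟨h1, h2, by omega⟩
end

section
/- Let k be a positive integer and let M ∈ 𝔽₂^{k×k} be a matrix that contains no 2×2 submatrix (on rows i₁ < i₂ and columns j₁ < j₂) equal to [[0,1],[1,0]] and none equal to [[1,0],[0,1]]. Then rank(M + I_k) ≥ k/2 − 1, where I_k is the k×k identity matrix and the rank is over 𝔽₂. -/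
open Module Matrix in
/-- Cutting a finite-dimensional subspace by one linear form lowers the dimension by at most 1. -/
lemma finrank_le_of_form {V : Type*} [AddCommGroup V] [Module (ZMod 2) V]
    [FiniteDimensional (ZMod 2) V] (W W' : Submodule (ZMod 2) V) (φ : V →ₗ[ZMod 2] ZMod 2)
    (h : ∀ y ∈ W, φ y = 0 → y ∈ W') : finrank (ZMod 2) W ≤ finrank (ZMod 2) W' + 1 := by
  have h1 := LinearMap.finrank_range_add_finrank_ker (φ.comp W.subtype)
  have h2 : finrank (ZMod 2) (LinearMap.range (φ.comp W.subtype)) ≤ 1 := by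
    have := Submodule.finrank_le (LinearMap.range (φ.comp W.subtype))
    simpa using this
  have h3 : finrank (ZMod 2) (LinearMap.ker (φ.comp W.subtype)) ≤ finrank (ZMod 2) W' := by
    have h4 : (LinearMap.ker (φ.comp W.subtype)).map W.subtype ≤ W' := by
      rintro _ ⟨y, hy, rfl⟩
      exact h _ y.2 hy
    have h5 := Submodule.finrank_mono h4
    rwa [(Submodule.equivMapOfInjective W.subtype W.injective_subtype _).finrank_eq.symm] at h5
  omega

/-- Sequences satisfying the first `j` recurrences. -/
def DD (k : ℕ) (t : Fin k → Fin (k+1)) (j : ℕ) : Submodule (ZMod 2) (Fin (k+1) → ZMod 2) where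
  carrier := {y | y 0 = 0 ∧ ∀ i : Fin k, i.val < j → y i.succ = y i.castSucc + y (t i)}
  zero_mem' := by simp
  add_mem' := by
    rintro a b ⟨ha, ha'⟩ ⟨hb, hb'⟩
    refine ⟨by simp [ha, hb], fun i hi => ?_⟩
    simp only [Pi.add_apply, ha' i hi, hb' i hi]
    ring
  smul_mem' := by
    rintro c a ⟨ha, ha'⟩
    refine ⟨by simp [ha], fun i hi => ?_⟩
    simp only [Pi.smul_apply, ha' i hi, smul_eq_mul]
    ring

/-- Those vanishing at all indices at least `j`. -/
def ZZ (k : ℕ) (t : Fin k → Fin (k+1)) (j : ℕ) : Submodule (ZMod 2) (Fin (k+1) → ZMod 2) where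
  carrier := {y | y ∈ DD k t j ∧ ∀ c : Fin (k+1), j ≤ c.val → y c = 0}
  zero_mem' := ⟨Submodule.zero_mem _, by simp⟩
  add_mem' := by
    rintro a b ⟨ha, ha'⟩ ⟨hb, hb'⟩
    exact ⟨Submodule.add_mem _ ha hb, fun c hc => by simp [ha' c hc, hb' c hc]⟩
  smul_mem' := by
    rintro c a ⟨ha, ha'⟩
    exact ⟨Submodule.smul_mem _ _ ha, fun d hd => by simp [ha' d hd]⟩

/-- Indices not yet touched. -/
def UU (k : ℕ) (t : Fin k → Fin (k+1)) (j : ℕ) : Finset (Fin (k+1)) :=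
  Finset.univ.filter (fun c => j < c.val ∧ ∀ i : Fin k, i.val < j → t i ≠ c)

lemma DD_anti (k : ℕ) (t : Fin k → Fin (k+1)) (j : ℕ) : DD k t (j+1) ≤ DD k t j :=
  fun _ hy => ⟨hy.1, fun i hi => hy.2 i (by omega)⟩

lemma single_mem_DD (k : ℕ) (t : Fin k → Fin (k+1)) (j : ℕ) (c : Fin (k+1)) (hc : c ∈ UU k t j) :
    (Pi.single c 1 : Fin (k+1) → ZMod 2) ∈ DD k t j := by
  simp only [UU, Finset.mem_filter, Finset.mem_univ, true_and] at hc
  refine ⟨Pi.single_eq_of_ne (by rintro rfl; simp at hc) _, fun i hi => ?_⟩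
  rw [Pi.single_eq_of_ne, Pi.single_eq_of_ne, Pi.single_eq_of_ne (hc.2 i hi), add_zero]
  · rintro rfl; simp at hc; omega
  · rintro rfl; simp at hc; omega

open Module Matrix in
lemma step_bound (k : ℕ) (t : Fin k → Fin (k+1)) (p : Fin k)
    (ih : finrank (ZMod 2) (DD k t p) + finrank (ZMod 2) (ZZ k t p) ≤ p + (UU k t p).card) :
    finrank (ZMod 2) (DD k t (p+1)) + finrank (ZMod 2) (ZZ k t (p+1))
      ≤ (p + 1) + (UU k t (p+1)).card := by
  have hD := Submodule.finrank_mono (DD_anti k t p)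
  have hZ : finrank (ZMod 2) (ZZ k t (p+1)) ≤ finrank (ZMod 2) (ZZ k t p) + 1 := by
    refine finrank_le_of_form _ _ (LinearMap.proj p.castSucc) fun y hy h0 => ?_
    refine ⟨DD_anti k t p hy.1, fun c hc => ?_⟩
    rcases Nat.eq_or_lt_of_le hc with h | h
    · have : c = p.castSucc := Fin.ext h.symm
      rw [this]; exact h0
    · exact hy.2 c h
  have hZ' : (p.val + 1 ≤ (t p).val) →
      finrank (ZMod 2) (ZZ k t (p+1)) ≤ finrank (ZMod 2) (ZZ k t p) := by
    intro ht
    refine Submodule.finrank_mono fun y hy => ⟨DD_anti k t p hy.1, fun c hc => ?_⟩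
    rcases Nat.eq_or_lt_of_le hc with h | h
    · have : c = p.castSucc := Fin.ext h.symm
      have h1 := hy.1.2 p (by omega)
      rw [hy.2 p.succ (by simp), hy.2 (t p) ht, add_zero] at h1
      rw [this, ← h1]
    · exact hy.2 c h
  have hDlt : ∀ c ∈ UU k t p, (c = p.succ ∨ c = t p) → t p ≠ p.succ →
      finrank (ZMod 2) (DD k t (p+1)) + 1 ≤ finrank (ZMod 2) (DD k t p) := by
    intro c hc hor hne
    refine Submodule.finrank_lt_finrank_of_lt (lt_of_le_of_ne (DD_anti k t p) fun heq => ?_)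
    have hm := single_mem_DD k t p c hc
    rw [← heq] at hm
    have h1 := hm.2 p (by omega)
    simp only [UU, Finset.mem_filter, Finset.mem_univ, true_and] at hc
    have h2 : p.castSucc ≠ c := by rintro rfl; simp at hc
    rw [Pi.single_eq_of_ne h2, zero_add] at h1
    rcases hor with rfl | rfl
    · rw [Pi.single_eq_same, Pi.single_eq_of_ne hne] at h1
      exact one_ne_zero h1
    · rw [Pi.single_eq_same, Pi.single_eq_of_ne hne.symm] at h1
      exact zero_ne_one h1
  have hU : UU k t (p+1) = ((UU k t p).erase p.succ).erase (t p) := by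
    ext c
    simp only [UU, Finset.mem_filter, Finset.mem_univ, true_and, Finset.mem_erase]
    constructor
    · rintro ⟨h1, h2⟩
      refine ⟨(h2 p (by omega)).symm, ?_, by omega, fun i hi => h2 i (by omega)⟩
      rintro rfl; simp at h1
    · rintro ⟨h1, h2, h3, h4⟩
      refine ⟨?_, fun i hi => ?_⟩
      · have : c.val ≠ p.val + 1 := fun h => h2 (Fin.ext (by simpa using h))
        omega
      · rcases Nat.lt_succ_iff_lt_or_eq.mp hi with h | h
        · exact h4 i h
        · have : i = p := Fin.ext h
          rw [this]; exact h1.symm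
  have hgt : t p ∈ UU k t p → p.val + 1 ≤ (t p).val := by
    intro h
    simp only [UU, Finset.mem_filter, Finset.mem_univ, true_and] at h
    omega
  have e1 := Finset.card_erase_add_one (s := UU k t p) (a := p.succ)
  have e2 := Finset.card_erase_add_one (s := (UU k t p).erase p.succ) (a := t p)
  rw [hU]
  by_cases hne : t p = p.succ
  · have hz := hZ' (by rw [hne]; simp)
    rw [hne, Finset.erase_idem]
    by_cases ha : p.succ ∈ UU k t p
    · have := e1 ha; omega
    · rw [Finset.erase_eq_of_notMem ha]; omega
  · by_cases ha : p.succ ∈ UU k t p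
    · have f1 := e1 ha
      have f2 := hDlt _ ha (Or.inl rfl) hne
      by_cases hb : t p ∈ UU k t p
      · have := e2 (Finset.mem_erase.mpr ⟨hne, hb⟩)
        have := hZ' (hgt hb)
        omega
      · rw [Finset.erase_eq_of_notMem (a := t p) (fun h => hb (Finset.mem_of_mem_erase h))]
        omega
    · rw [Finset.erase_eq_of_notMem ha] at e2 ⊢
      by_cases hb : t p ∈ UU k t p
      · have := e2 hb
        have := hDlt _ hb (Or.inr rfl) hne
        omega
      · rw [Finset.erase_eq_of_notMem hb]; omega

open Module Matrix in
lemma main_bound (k : ℕ) (t : Fin k → Fin (k+1)) (j : ℕ) (hj : j ≤ k) :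
    finrank (ZMod 2) (DD k t j) + finrank (ZMod 2) (ZZ k t j) ≤ j + (UU k t j).card := by
  induction j with
  | zero =>
    have hZ : ZZ k t 0 = ⊥ := by
      rw [eq_bot_iff]
      intro y hy
      rw [Submodule.mem_bot]
      funext c
      exact hy.2 c (Nat.zero_le _)
    have hD : finrank (ZMod 2) (DD k t 0) < finrank (ZMod 2) (Fin (k+1) → ZMod 2) := by
      refine Submodule.finrank_lt fun h => ?_
      have h1 : (fun _ => 1 : Fin (k+1) → ZMod 2) ∈ DD k t 0 := by rw [h]; trivial
      exact one_ne_zero h1.1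
    have hU : UU k t 0 = Finset.univ.erase 0 := by
      ext c
      simp [UU, Fin.pos_iff_ne_zero]
    rw [hZ, hU, Finset.card_erase_of_mem (Finset.mem_univ _)]
    simp at hD ⊢
    omega
  | succ j ih => exact step_bound k t ⟨j, hj⟩ (ih (by omega))

open Module Matrix in
lemma final_bound (k : ℕ) (t : Fin k → Fin (k+1)) :
    2 * finrank (ZMod 2) (DD k t k) ≤ k + 1 := by
  have h := main_bound k t k le_rfl
  have hU : UU k t k = ∅ := by
    ext c
    simp only [UU, Finset.mem_filter, Finset.mem_univ, true_and, Finset.notMem_empty, iff_false]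
    rintro ⟨h, -⟩
    omega
  have hZ : finrank (ZMod 2) (DD k t k) ≤ finrank (ZMod 2) (ZZ k t k) + 1 := by
    refine finrank_le_of_form _ _ (LinearMap.proj (Fin.last k)) fun y hy h0 => ⟨hy, fun c hc => ?_⟩
    have : c = Fin.last k := Fin.ext (by simp; omega)
    rw [this]; exact h0
  rw [hU, Finset.card_empty] at h
  omega

/-- Partial sums. -/
def cumSum (k : ℕ) : (Fin k → ZMod 2) →ₗ[ZMod 2] (Fin (k+1) → ZMod 2) where
  toFun x c := ∑ i : Fin k, if i.val < c.val then x i else 0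
  map_add' x y := by
    funext c
    simp only [Pi.add_apply, ← Finset.sum_add_distrib]
    refine Finset.sum_congr rfl fun i _ => ?_
    split_ifs <;> simp
  map_smul' r x := by
    funext c
    simp only [Pi.smul_apply, smul_eq_mul, Finset.mul_sum, RingHom.id_apply]
    refine Finset.sum_congr rfl fun i _ => ?_
    split_ifs <;> simp

lemma cumSum_apply (k : ℕ) (x : Fin k → ZMod 2) (c : Fin (k+1)) :
    cumSum k x c = ∑ i : Fin k, if i.val < c.val then x i else 0 := rfl

lemma cumSum_succ (k : ℕ) (x : Fin k → ZMod 2) (i : Fin k) :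
    cumSum k x i.succ = cumSum k x i.castSucc + x i := by
  have hx : x i = ∑ a : Fin k, if a = i then x a else 0 := by simp
  rw [cumSum_apply, cumSum_apply, hx, ← Finset.sum_add_distrib]
  refine Finset.sum_congr rfl fun a _ => ?_
  rcases lt_trichotomy a i with h | h | h
  · have h1 : a.val < i.val := h
    simp [h1, h.ne, Nat.lt_succ_of_lt h1]
  · simp [h]
  · have h1 : i.val < a.val := h
    simp [h.ne', Nat.not_lt.mpr h1.le]
    intro h2; omega

open Module Matrix in
/-- The sorted case. -/
lemma rank_sorted (k : ℕ) (t : Fin k → Fin (k+1)) (M : Matrix (Fin k) (Fin k) (ZMod 2))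
    (hM : ∀ i j, M i j = if i.val < (t j).val then 1 else 0) : k ≤ 2 * (M + 1).rank + 1 := by
  have h1 := LinearMap.finrank_range_add_finrank_ker ((M + 1)ᵀ).mulVecLin
  change ((M + 1)ᵀ).rank + _ = _ at h1
  rw [Matrix.rank_transpose, Module.finrank_fin_fun] at h1
  have hinj : Function.Injective (cumSum k) := by
    intro x y h
    funext i
    have h2 := cumSum_succ k x i
    rw [h, cumSum_succ k y i] at h2
    exact (add_left_cancel h2).symm
  have h2 : (LinearMap.ker ((M + 1)ᵀ).mulVecLin).map (cumSum k) ≤ DD k t k := by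
    rintro _ ⟨x, hx, rfl⟩
    refine ⟨by simp [cumSum_apply], fun j _ => ?_⟩
    have h3 : ((M + 1)ᵀ).mulVec x j = 0 := congrFun hx j
    rw [Matrix.transpose_add, Matrix.transpose_one, Matrix.add_mulVec, Matrix.one_mulVec,
      Pi.add_apply] at h3
    have h4 : Mᵀ.mulVec x j = cumSum k x (t j) := by
      rw [cumSum_apply]
      change ∑ i, M i j * x i = _
      refine Finset.sum_congr rfl fun i _ => ?_
      simp [hM]
    rw [h4] at h3
    rw [cumSum_succ, CharTwo.add_eq_zero.mp h3]
  have h3 := Submodule.finrank_mono h2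
  rw [(Submodule.equivMapOfInjective (cumSum k) hinj _).finrank_eq.symm] at h3
  have h4 := final_bound k t
  omega

lemma zmod2_ne_one {a : ZMod 2} (h : a ≠ 1) : a = 0 := by
  revert a; decide

/-- if `M ∈ 𝔽₂^{k×k}` contains no `2 × 2` submatrix equal to
`[[0,1],[1,0]]` and none equal to `[[1,0],[0,1]]`, then `rank(M + I) ≥ k/2 - 1`. -/
theorem rank_add_id_of_no_bad_submatrix (k : ℕ) (hk : 0 < k)
    (M : Matrix (Fin k) (Fin k) (ZMod 2))
    (h01 : ∀ i₁ i₂ j₁ j₂ : Fin k, i₁ < i₂ → j₁ < j₂ →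
      ¬(M i₁ j₁ = 0 ∧ M i₁ j₂ = 1 ∧ M i₂ j₁ = 1 ∧ M i₂ j₂ = 0))
    (h10 : ∀ i₁ i₂ j₁ j₂ : Fin k, i₁ < i₂ → j₁ < j₂ →
      ¬(M i₁ j₁ = 1 ∧ M i₁ j₂ = 0 ∧ M i₂ j₁ = 0 ∧ M i₂ j₂ = 1)) :
    (k : ℝ) / 2 - 1 ≤ (((M + 1).rank : ℕ) : ℝ) := by
  have hno : ∀ a b c d : Fin k, M a c = 1 → M a d = 0 → M b c = 0 → M b d = 1 → False := by
    intro a b c d h1 h2 h3 h4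
    have hab : a ≠ b := by rintro rfl; rw [h1] at h3; exact one_ne_zero h3
    have hcd : c ≠ d := by rintro rfl; rw [h1] at h2; exact one_ne_zero h2
    rcases lt_or_gt_of_ne hab with h | h <;> rcases lt_or_gt_of_ne hcd with h' | h'
    · exact h10 a b c d h h' ⟨h1, h2, h3, h4⟩
    · exact h01 a b d c h h' ⟨h2, h1, h4, h3⟩
    · exact h01 b a c d h h' ⟨h3, h4, h1, h2⟩
    · exact h10 b a d c h h' ⟨h4, h3, h2, h1⟩
  let f : Fin k → ℕ := fun i => (Finset.univ.filter (fun j => M i j = 0)).card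
  let σ := Tuple.sort f
  have hmono : Monotone (f ∘ σ) := Tuple.monotone_sort f
  let N : Matrix (Fin k) (Fin k) (ZMod 2) := M.submatrix σ σ
  have hanti : ∀ i i' j, i' ≤ i → N i j = 1 → N i' j = 1 := by
    intro i i' j hle h1
    by_contra h2
    have h2' : M (σ i') (σ j) = 0 := zmod2_ne_one h2
    have h1' : M (σ i) (σ j) = 1 := h1
    have hlt : f (σ i) < f (σ i') := by
      refine Finset.card_lt_card ?_
      rw [Finset.ssubset_iff_of_subset]
      · exact ⟨σ j, by simp [h2'], by simp [h1']⟩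
      · intro c hc
        simp only [Finset.mem_filter, Finset.mem_univ, true_and] at hc ⊢
        by_contra h3
        have h3' : M (σ i') c = 1 := by
          by_contra h5
          exact h3 (zmod2_ne_one h5)
        exact hno _ _ _ _ h1' hc h2' h3'
    exact absurd (hmono hle) (not_le.mpr hlt)
  have ht : ∀ j, ∃ t : Fin (k+1), ∀ i : Fin k, N i j = if i.val < t.val then 1 else 0 := by
    intro j
    let s := (Finset.univ.filter (fun i => N i j = 1)).sup (fun i : Fin k => i.val + 1)
    have hs : s ≤ k := Finset.sup_le fun i _ => i.2
    refine ⟨⟨s, by omega⟩, fun i => ?_⟩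
    split_ifs with h
    · obtain ⟨b, hb, hlt⟩ := Finset.lt_sup_iff.mp (show i.val < s from h)
      simp only [Finset.mem_filter, Finset.mem_univ, true_and] at hb
      exact hanti b i j (by rw [Fin.le_def]; omega) hb
    · refine zmod2_ne_one fun h1 => h ?_
      exact Finset.le_sup (f := fun i : Fin k => i.val + 1)
        (Finset.mem_filter.mpr ⟨Finset.mem_univ i, h1⟩)
  choose t ht using ht
  have hr := rank_sorted k t N (fun i j => ht j i)
  have hN : N + 1 = (M + 1).submatrix σ σ := by
    rw [Matrix.submatrix_add, Pi.add_apply, Pi.add_apply, Matrix.submatrix_one_equiv]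
  rw [hN, Matrix.rank_submatrix] at hr
  have hr' : (k : ℝ) ≤ 2 * ((M + 1).rank : ℝ) + 1 := by exact_mod_cast hr
  linarith
end
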